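/- Let $V : \mathbb{R}_{\geq 0} \times \mathbb{R}^n \to \mathbb{R} \cup \{+\infty\}$ be jointly convex on the convex set $(\hat{\lambda}, \infty) \times \mathbb{R}^n$, and for matrices $A \in \mathbb{R}^{n\times n}$, $B \in \mathbb{R}^{n\times m}$, $\Xi \in \mathbb{R}^{n\times k}$, $R \in \mathbb{S}_{++}^m$, $Q \in \mathbb{S}_+^n$, and fixed points $\hat{w}^{(1)},\dots,\hat{w}^{(N)} \in \mathbb{R}^k$, define $V'(\lambda, x) := x^\top Q x + \inf_{u \in \mathbb{R}^m}\big[u^\top R u + \frac{1}{N}\sum_{i=1}^N \sup_{w \in \mathbb{R}^k}\{V(\lambda, Ax + Bu + \Xi w) - \lambda\|\hat{w}^{(i)} - w\|^2\}\big]$. Then $V'$ is jointly convex in $(\lambda, x)$ on $(\hat{\lambda}, \infty) \times \mathbb{R}^n$. -/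

import Mathlib

open Matrix

/-- Convexity of an extended-real-valued function on a set, with respect to the addition of `EReal`
(for which `⊥ + ⊤ = ⊥`). -/
def ERealConvexOn {E : Type*} [AddCommGroup E] [Module ℝ E] (s : Set E) (f : E → EReal) : Prop :=
  ∀ ⦃x⦄, x ∈ s → ∀ ⦃y⦄, y ∈ s → ∀ ⦃a b : ℝ⦄, 0 ≤ a → 0 ≤ b → a + b = 1 →
    f (a • x + b • y) ≤ (a : EReal) * f x + (b : EReal) * f y

theorem EReal.coe_mul_add_of_nonneg {c : ℝ} (hc : 0 ≤ c) (x y : EReal) :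
    (c : EReal) * (x + y) = c * x + c * y :=
  EReal.left_distrib_of_nonneg_of_ne_top (EReal.coe_nonneg.2 hc) (EReal.coe_ne_top c) x y

theorem EReal.exists_coe_mul_lt_of_coe_mul_iInf_lt {ι : Type*} {a : ℝ} (ha : 0 < a)
    {f : ι → EReal} {c : EReal} (h : (a : EReal) * ⨅ i, f i < c) : ∃ i, (a : EReal) * f i < c := by
  by_contra! hc
  have key (x : EReal) : c / a ≤ x ↔ c ≤ a * x :=
    EReal.div_le_iff_le_mul (EReal.coe_pos.2 ha) (EReal.coe_ne_top a)
  exact h.not_ge ((key _).1 (le_iInf fun i => (key _).2 (hc i)))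

namespace ERealConvexOn

variable {E F ι : Type*} [AddCommGroup E] [Module ℝ E] [AddCommGroup F] [Module ℝ F]
  {s : Set E} {f g : E → EReal}

theorem add (hf : ERealConvexOn s f) (hg : ERealConvexOn s g) :
    ERealConvexOn s (fun x => f x + g x) := by
  intro x hx y hy a b ha hb hab
  refine (add_le_add (hf hx hy ha hb hab) (hg hx hy ha hb hab)).trans_eq ?_
  rw [EReal.coe_mul_add_of_nonneg ha, EReal.coe_mul_add_of_nonneg hb, add_add_add_comm]

theorem coe_mul (hf : ERealConvexOn s f) {c : ℝ} (hc : 0 ≤ c) :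
    ERealConvexOn s (fun x => (c : EReal) * f x) := by
  intro x hx y hy a b ha hb hab
  refine (mul_le_mul_of_nonneg_left (hf hx hy ha hb hab) (EReal.coe_nonneg.2 hc)).trans_eq ?_
  rw [EReal.coe_mul_add_of_nonneg hc, mul_left_comm, mul_left_comm (c : EReal)]

theorem iSup {f : ι → E → EReal} (hf : ∀ i, ERealConvexOn s (f i)) :
    ERealConvexOn s (fun x => ⨆ i, f i x) := by
  intro x hx y hy a b ha hb hab
  refine iSup_le fun i => (hf i hx hy ha hb hab).trans (add_le_add ?_ ?_)
  · exact mul_le_mul_of_nonneg_left (le_iSup (fun i => f i x) i) (EReal.coe_nonneg.2 ha)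
  · exact mul_le_mul_of_nonneg_left (le_iSup (fun i => f i y) i) (EReal.coe_nonneg.2 hb)

theorem _root_.ConvexOn.erealConvexOn {φ : E → ℝ} (hφ : ConvexOn ℝ s φ) :
    ERealConvexOn s (fun x => (φ x : EReal)) := by
  intro x hx y hy a b ha hb hab
  have h := hφ.2 hx hy ha hb hab
  simp only [smul_eq_mul] at h
  dsimp only
  exact_mod_cast h

theorem sum (t : Finset ι) {f : ι → E → EReal} (hf : ∀ i ∈ t, ERealConvexOn s (f i)) :
    ERealConvexOn s (fun x => ∑ i ∈ t, f i x) := by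
  induction t using Finset.cons_induction with
  | empty => intro x _ y _ a b _ _ _; simp
  | cons i t hi ih =>
    simp only [Finset.sum_cons]
    exact (hf i (Finset.mem_cons_self i t)).add
      (ih fun j hj => hf j (Finset.mem_cons_of_mem hj))

/-- Partial minimization preserves convexity, provided that the infimum is only `⊥` where it is
attained. -/
theorem iInf {f : E × F → EReal} (hf : ERealConvexOn (s ×ˢ Set.univ) f)
    (hbot : ∀ x ∈ s, ⨅ u, f (x, u) = ⊥ → ∃ u, f (x, u) = ⊥) :
    ERealConvexOn s (fun x => ⨅ u, f (x, u)) := by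
  intro x hx y hy a b ha hb hab
  rcases ha.eq_or_lt with rfl | ha'
  · obtain rfl : b = 1 := by linarith
    simp
  rcases hb.eq_or_lt with rfl | hb'
  · obtain rfl : a = 1 := by linarith
    simp
  have key (u v : F) : ⨅ w, f (a • x + b • y, w) ≤ (a : EReal) * f (x, u) + b * f (y, v) :=
    (iInf_le _ (a • u + b • v)).trans
      (hf (x := (x, u)) ⟨hx, trivial⟩ (y := (y, v)) ⟨hy, trivial⟩ ha hb hab)
  have mul_ne_bot {c : ℝ} (hc : 0 < c) {z : EReal} (hz : z ≠ ⊥) : (c : EReal) * z ≠ ⊥ := by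
    induction z with
    | bot => exact absurd rfl hz
    | top => simp [EReal.coe_mul_top_of_pos hc]
    | coe z => exact_mod_cast EReal.coe_ne_bot (c * z)
  by_cases hxbot : ⨅ u, f (x, u) = ⊥
  · obtain ⟨u, hu⟩ := hbot x hx hxbot
    exact (key u 0).trans (by simp [hu, EReal.coe_mul_bot_of_pos ha'])
  by_cases hybot : ⨅ u, f (y, u) = ⊥
  · obtain ⟨v, hv⟩ := hbot y hy hybot
    exact (key 0 v).trans (by simp [hv, EReal.coe_mul_bot_of_pos hb'])
  refine EReal.le_add_of_forall_gt (.inl (mul_ne_bot ha' hxbot)) (.inr (mul_ne_bot hb' hybot)) ?_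
  intro c hc d hd
  obtain ⟨u, hu⟩ := EReal.exists_coe_mul_lt_of_coe_mul_iInf_lt ha' hc
  obtain ⟨v, hv⟩ := EReal.exists_coe_mul_lt_of_coe_mul_iInf_lt hb' hd
  exact (key u v).trans (add_le_add hu.le hv.le)

/-- The restriction of a convex function without the value `⊥` to its effective domain. -/
theorem convexOn_toReal {f : E → EReal} (hf : ERealConvexOn Set.univ f) (hbot : ∀ x, f x ≠ ⊥) :
    ConvexOn ℝ {x | f x ≠ ⊤} (fun x => (f x).toReal) := by
  have key {x y : E} (hx : f x ≠ ⊤) (hy : f y ≠ ⊤) {a b : ℝ} (ha : 0 ≤ a) (hb : 0 ≤ b)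
      (hab : a + b = 1) :
      f (a • x + b • y) ≤ ((a * (f x).toReal + b * (f y).toReal : ℝ) : EReal) := by
    have := hf (Set.mem_univ x) (Set.mem_univ y) ha hb hab
    rw [← EReal.coe_toReal hx (hbot x), ← EReal.coe_toReal hy (hbot y)] at this
    exact_mod_cast this
  refine ⟨fun x hx y hy a b ha hb hab => ?_, fun x hx y hy a b ha hb hab => ?_⟩
  · exact ne_top_of_le_ne_top (EReal.coe_ne_top _) (key hx hy ha hb hab)
  · exact EReal.toReal_le_toReal (key hx hy ha hb hab) (hbot _) (EReal.coe_ne_top _)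

end ERealConvexOn

/-- A convex function on a subset of a finite-dimensional space has a lower bound which is affine
in the norm. -/
theorem ConvexOn.exists_neg_mul_one_add_norm_le {E : Type*} [NormedAddCommGroup E]
    [NormedSpace ℝ E] [FiniteDimensional ℝ E] {s : Set E} {φ : E → ℝ} (hφ : ConvexOn ℝ s φ) :
    ∃ K : ℝ, ∀ u ∈ s, -(K * (1 + ‖u‖)) ≤ φ u := by
  rcases s.eq_empty_or_nonempty with rfl | ⟨p, hp⟩
  · exact ⟨0, by simp⟩
  obtain ⟨t, hts, hspan, hli⟩ := exists_linearIndependent ℝ ((· - p) '' s)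
  have : Fintype t := hli.setFinite.fintype
  have hpt (v : t) : p + (v : E) ∈ s := by
    obtain ⟨u, hu, huv⟩ := hts v.2
    simpa [← huv] using hu
  set L : (t → ℝ) →ₗ[ℝ] E := Fintype.linearCombination ℝ (fun v : t => (v : E)) with hL
  obtain ⟨K, -, hK⟩ := L.exists_antilipschitzWith
    (LinearMap.ker_eq_bot.2 (linearIndependent_iff_injective_fintypeLinearCombination.1 hli))
  have hsimplex (c : t → ℝ) (h₀ : ∀ v, 0 ≤ c v) (h₁ : ∑ v, c v ≤ 1) :
      p + L c ∈ s ∧ φ (p + L c) ≤ |φ p| + ∑ v : t, |φ (p + v)| := by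
    let w : Option t → ℝ := fun o => o.elim (1 - ∑ v, c v) c
    let q : Option t → E := fun o => o.elim p (fun v => p + v)
    have hw : ∀ o ∈ Finset.univ, 0 ≤ w o := by
      rintro (_ | v) -
      exacts [sub_nonneg.2 h₁, h₀ v]
    have hw₁ : ∑ o, w o = 1 := by simp [w, Fintype.sum_option]
    have hq : ∀ o ∈ Finset.univ, q o ∈ s := by
      rintro (_ | v) -
      exacts [hp, hpt v]
    have heq : ∑ o, w o • q o = p + L c := by
      simp only [Fintype.sum_option, w, q, Option.elim, smul_add, Finset.sum_add_distrib, hL,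
        Fintype.linearCombination_apply, ← Finset.sum_smul]
      module
    rw [← heq]
    refine ⟨hφ.1.sum_mem hw hw₁ hq, (hφ.map_sum_le hw hw₁ hq).trans ?_⟩
    have hle : ∑ o, w o • φ (q o) ≤ ∑ o, |φ (q o)| := by
      refine Finset.sum_le_sum fun o ho => ?_
      have h1 : w o ≤ 1 := hw₁ ▸ Finset.single_le_sum hw ho
      calc w o * φ (q o) ≤ w o * |φ (q o)| := mul_le_mul_of_nonneg_left (le_abs_self _) (hw o ho)
        _ ≤ |φ (q o)| := mul_le_of_le_one_left (abs_nonneg _) h1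
    simpa [Fintype.sum_option, q] using hle
  set M := |φ p| + ∑ v : t, |φ (p + v)|
  set d : ℝ := (Fintype.card t : ℝ) with hd
  have hd0 : 0 ≤ d := Nat.cast_nonneg _
  set e : ℝ := 1 / (d + 1) with he
  have he0 : 0 < e := by positivity
  have hde : d * e + e = 1 := by rw [he]; field_simp
  set u₀ := p + L (fun _ => e) with hu₀
  refine ⟨|φ u₀| + |φ u₀ - M| * ((d + 1) * (1 + (d + 1) * (K * (1 + ‖p‖)))), fun u hu => ?_⟩
  obtain ⟨c, hc⟩ : ∃ c, L c = u - p := by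
    have : u - p ∈ Submodule.span ℝ t := hspan ▸ Submodule.subset_span ⟨u, hu, rfl⟩
    rw [← LinearMap.mem_range, hL, Fintype.range_linearCombination]
    simpa using this
  set r : ℝ := K * (‖u‖ + ‖p‖) with hr
  have hr0 : 0 ≤ r := by positivity
  have hcr (v : t) : |c v| ≤ r := by
    have h := hK.le_mul_dist c 0
    rw [map_zero, dist_zero_right, dist_zero_right, hc] at h
    exact (norm_le_pi_norm c v).trans
      (h.trans (mul_le_mul_of_nonneg_left (norm_sub_le u p) K.2))
  set ε : ℝ := e / (1 + (d + 1) * r) with hε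
  have hε0 : 0 < ε := by positivity
  have hεe : ε + ε * (d * r) + ε * r = e := by rw [hε]; field_simp; ring
  have hεdr : 0 ≤ ε * (d * r) := by positivity
  have hεr : 0 ≤ ε * r := by positivity
  -- the reflection of `u` through the barycenter `u₀`
  obtain ⟨hvs, hvM⟩ := hsimplex (fun v => e - ε * (c v - e))
    (fun v => by
      have := mul_le_mul_of_nonneg_left ((le_abs_self _).trans (hcr v)) hε0.le
      have : 0 ≤ ε * e := by positivity
      simp only [mul_sub]
      linarith)
    (by
      have h : -(d * r) ≤ ∑ v, c v := by
        have := Finset.sum_le_sum fun v (_ : v ∈ Finset.univ) => (abs_le.1 (hcr v)).1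
        simpa [hd] using this
      have := mul_le_mul_of_nonneg_left h hε0.le
      simp only [Finset.sum_sub_distrib, ← Finset.mul_sum, Finset.sum_const, Finset.card_univ,
        nsmul_eq_mul, ← hd]
      nlinarith)
  have hLv : p + L (fun v => e - ε * (c v - e)) = u₀ - ε • (u - u₀) := by
    have : (fun v => e - ε * (c v - e)) = (fun _ => e) - ε • (c - fun _ => e) := by
      ext v; simp
    rw [this, map_sub, map_smul, map_sub, hc, hu₀]
    module
  rw [hLv] at hvs hvM
  have hconv := hφ.2 hu hvs (show 0 ≤ ε / (1 + ε) by positivity)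
    (show 0 ≤ 1 / (1 + ε) by positivity) (by field_simp; ring)
  have hmid : (ε / (1 + ε)) • u + (1 / (1 + ε)) • (u₀ - ε • (u - u₀)) = u₀ := by
    have : (ε / (1 + ε)) • u + (1 / (1 + ε)) • (u₀ - ε • (u - u₀))
      = ((1 / (1 + ε)) * (1 + ε)) • u₀ := by module
    rw [this, one_div, inv_mul_cancel₀ (by positivity), one_smul]
  rw [hmid, smul_eq_mul, smul_eq_mul] at hconv
  have hmul : (1 + ε) * φ u₀ ≤ ε * φ u + M := by
    have : (1 + ε) * φ u₀ ≤ ε * φ u + φ (u₀ - ε • (u - u₀)) := by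
      calc _ ≤ (1 + ε) * _ := mul_le_mul_of_nonneg_left hconv (by positivity)
        _ = _ := by field_simp
    linarith
  have hinv : ε⁻¹ = (d + 1) * (1 + (d + 1) * r) := by rw [hε, he]; field_simp
  have hlow : φ u₀ + (φ u₀ - M) * ε⁻¹ ≤ φ u := by
    have : φ u₀ + (φ u₀ - M) * ε⁻¹ = ε⁻¹ * ((1 + ε) * φ u₀ - M) := by field_simp; ring
    rw [this, inv_mul_le_iff₀ hε0]
    linarith
  have hεbound : ε⁻¹ ≤ (d + 1) * (1 + (d + 1) * (K * (1 + ‖p‖))) * (1 + ‖u‖) := by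
    rw [hinv, mul_assoc]
    refine mul_le_mul_of_nonneg_left ?_ (by positivity)
    have h : r ≤ K * (1 + ‖p‖) * (1 + ‖u‖) := by
      rw [hr, mul_assoc]
      refine mul_le_mul_of_nonneg_left ?_ K.2
      nlinarith [norm_nonneg u, norm_nonneg p, mul_nonneg (norm_nonneg u) (norm_nonneg p)]
    have := mul_le_mul_of_nonneg_left h (by positivity : 0 ≤ d + 1)
    nlinarith [norm_nonneg u]
  have h1 : -(|φ u₀ - M| * ε⁻¹) ≤ (φ u₀ - M) * ε⁻¹ := by
    rw [← neg_mul]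
    exact mul_le_mul_of_nonneg_right (neg_abs_le _) (by positivity)
  have h2 := mul_le_mul_of_nonneg_left hεbound (abs_nonneg (φ u₀ - M))
  have h3 : 0 ≤ |φ u₀| * ‖u‖ := by positivity
  linarith [neg_abs_le (φ u₀)]

theorem Matrix.PosSemidef.convexOn_dotProduct_mulVec {ι : Type*} [Fintype ι]
    {Q : Matrix ι ι ℝ} (hQ : Q.PosSemidef) :
    ConvexOn ℝ Set.univ (fun x : ι → ℝ => x ⬝ᵥ (Q *ᵥ x)) := by
  refine ⟨convex_univ, fun x _ y _ a b ha hb hab => ?_⟩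
  have h : 0 ≤ (x - y) ⬝ᵥ (Q *ᵥ (x - y)) := by simpa using hQ.dotProduct_mulVec_nonneg (x - y)
  have := mul_nonneg (mul_nonneg ha hb) h
  obtain rfl : b = 1 - a := by linarith
  simp only [mulVec_add, mulVec_sub, mulVec_smul, dotProduct_add, dotProduct_sub, add_dotProduct,
    sub_dotProduct, smul_dotProduct, dotProduct_smul, smul_eq_mul] at this ⊢
  nlinarith

theorem Matrix.PosDef.exists_pos_mul_norm_sq_le {ι : Type*} [Fintype ι]
    {R : Matrix ι ι ℝ} (hR : R.PosDef) :
    ∃ c : ℝ, 0 < c ∧ ∀ u : ι → ℝ, c * ‖u‖ ^ 2 ≤ u ⬝ᵥ (R *ᵥ u) := by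
  have hpos {u : ι → ℝ} (hu : u ≠ 0) : 0 < u ⬝ᵥ (R *ᵥ u) := by
    simpa using hR.dotProduct_mulVec_pos hu
  have hcont : Continuous fun u : ι → ℝ => u ⬝ᵥ (R *ᵥ u) := by fun_prop
  rcases (Metric.sphere (0 : ι → ℝ) 1).eq_empty_or_nonempty with hS | hS
  · refine ⟨1, one_pos, fun u => ?_⟩
    obtain rfl : u = 0 := by
      by_contra hu
      exact hS.le (show ‖u‖⁻¹ • u ∈ Metric.sphere (0 : ι → ℝ) 1 by
        simp [norm_smul, inv_mul_cancel₀ (norm_ne_zero_iff.2 hu)])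
    simp
  · obtain ⟨v, hv, hmin⟩ := (isCompact_sphere (0 : ι → ℝ) 1).exists_isMinOn hS hcont.continuousOn
    refine ⟨_, hpos (ne_zero_of_mem_unit_sphere ⟨v, hv⟩), fun u => ?_⟩
    rcases eq_or_ne u 0 with rfl | hu
    · simp
    have hu' := norm_pos_iff.2 hu
    have h := isMinOn_iff.1 hmin (‖u‖⁻¹ • u)
      (by simp [norm_smul, inv_mul_cancel₀ (norm_ne_zero_iff.2 hu)])
    simp only [mulVec_smul, smul_dotProduct, dotProduct_smul, smul_eq_mul] at h
    refine (mul_le_mul_of_nonneg_right h (sq_nonneg ‖u‖)).trans_eq ?_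
    field_simp

/-- Adding a positive definite quadratic form to a convex function makes it bounded below, unless
the function takes the value `⊥`. -/
theorem ERealConvexOn.exists_eq_bot_of_iInf_eq_bot {ι : Type*} [Fintype ι] {R : Matrix ι ι ℝ}
    (hR : R.PosDef) {h : (ι → ℝ) → EReal} (hh : ERealConvexOn Set.univ h)
    (hinf : ⨅ u, (((u ⬝ᵥ (R *ᵥ u) : ℝ) : EReal) + h u) = ⊥) : ∃ u, h u = ⊥ := by
  by_contra! hbot
  obtain ⟨K, hK⟩ := (hh.convexOn_toReal hbot).exists_neg_mul_one_add_norm_le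
  obtain ⟨c, hc, hcR⟩ := hR.exists_pos_mul_norm_sq_le
  have hle : ((-K - K ^ 2 / (4 * c) : ℝ) : EReal) ≤
      ⨅ u, (((u ⬝ᵥ (R *ᵥ u) : ℝ) : EReal) + h u) := by
    refine le_iInf fun u => ?_
    by_cases hu : h u = ⊤
    · simp [hu]
    rw [← EReal.coe_toReal hu (hbot u), ← EReal.coe_add, EReal.coe_le_coe_iff]
    have hsq : 0 ≤ c * (‖u‖ - K / (2 * c)) ^ 2 := by positivity
    have : c * (‖u‖ - K / (2 * c)) ^ 2 = c * ‖u‖ ^ 2 - K * ‖u‖ + K ^ 2 / (4 * c) := by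
      field_simp
      ring
    linarith [hK u hu, hcR u]
  rw [hinf, le_bot_iff] at hle
  exact EReal.coe_ne_bot _ hle

theorem stmt13 {n m k N : ℕ}
    (A : Matrix (Fin n) (Fin n) ℝ) (B : Matrix (Fin n) (Fin m) ℝ)
    (Ξ : Matrix (Fin n) (Fin k) ℝ) (R : Matrix (Fin m) (Fin m) ℝ)
    (Q : Matrix (Fin n) (Fin n) ℝ) (hR : R.PosDef) (hQ : Q.PosSemidef)
    (what : Fin N → Fin k → ℝ) (lamhat : ℝ)
    (V : ℝ → (Fin n → ℝ) → EReal)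
    (hV : ∀ l1 l2 : ℝ, ∀ x1 x2 : Fin n → ℝ, ∀ a b : ℝ,
      lamhat < l1 → lamhat < l2 → 0 ≤ a → 0 ≤ b → a + b = 1 →
      V (a * l1 + b * l2) (a • x1 + b • x2) ≤
        (a : EReal) * V l1 x1 + (b : EReal) * V l2 x2) :
    let V' : ℝ → (Fin n → ℝ) → EReal := fun lam x =>
      ((x ⬝ᵥ (Q *ᵥ x) : ℝ) : EReal) +
        ⨅ u : Fin m → ℝ, (((u ⬝ᵥ (R *ᵥ u) : ℝ) : EReal) +
          (((N : ℝ)⁻¹ : ℝ) : EReal) * ∑ i : Fin N,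
            ⨆ w : Fin k → ℝ,
              (V lam (A *ᵥ x + B *ᵥ u + Ξ *ᵥ w) -
                ((lam * ((what i - w) ⬝ᵥ (what i - w)) : ℝ) : EReal)))
    ∀ l1 l2 : ℝ, ∀ x1 x2 : Fin n → ℝ, ∀ a b : ℝ,
      lamhat < l1 → lamhat < l2 → 0 ≤ a → 0 ≤ b → a + b = 1 →
      V' (a * l1 + b * l2) (a • x1 + b • x2) ≤
        (a : EReal) * V' l1 x1 + (b : EReal) * V' l2 x2 := by
  have hlam : ERealConvexOn {p : ℝ × (Fin n → ℝ) | lamhat < p.1} (fun p => V p.1 p.2) :=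
    fun p hp q hq a b ha hb hab => hV p.1 q.1 p.2 q.2 a b hp hq ha hb hab
  set S : Set (ℝ × (Fin n → ℝ)) := {p | lamhat < p.1}
  let h : (ℝ × (Fin n → ℝ)) × (Fin m → ℝ) → EReal := fun z =>
    (((N : ℝ)⁻¹ : ℝ) : EReal) * ∑ i : Fin N, ⨆ w : Fin k → ℝ,
      (V z.1.1 (A *ᵥ z.1.2 + B *ᵥ z.2 + Ξ *ᵥ w) -
        ((z.1.1 * ((what i - w) ⬝ᵥ (what i - w)) : ℝ) : EReal))
  have hh : ERealConvexOn (S ×ˢ Set.univ) h := by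
    refine (ERealConvexOn.sum _ fun i _ => ERealConvexOn.iSup fun w => ?_).coe_mul (by positivity)
    simp only [sub_eq_add_neg, ← EReal.coe_neg]
    refine ERealConvexOn.add ?_ (ConvexOn.erealConvexOn (s := S ×ˢ Set.univ)
      ⟨?_, fun z _ z' _ a b _ _ _ => le_of_eq ?_⟩)
    · intro z hz z' hz' a b ha hb hab
      have := hlam (x := (z.1.1, A *ᵥ z.1.2 + B *ᵥ z.2 + Ξ *ᵥ w)) hz.1
        (y := (z'.1.1, A *ᵥ z'.1.2 + B *ᵥ z'.2 + Ξ *ᵥ w)) hz'.1 ha hb hab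
      have harg : A *ᵥ (a • z + b • z').1.2 + B *ᵥ (a • z + b • z').2 + Ξ *ᵥ w =
          a • (A *ᵥ z.1.2 + B *ᵥ z.2 + Ξ *ᵥ w) + b • (A *ᵥ z'.1.2 + B *ᵥ z'.2 + Ξ *ᵥ w) := by
        simp only [Prod.fst_add, Prod.snd_add, Prod.smul_fst, Prod.smul_snd, mulVec_add,
          mulVec_smul]
        obtain rfl : b = 1 - a := by linarith
        module
      simpa only [harg] using! this
    · exact ((convex_Ioi lamhat).linear_preimage (LinearMap.fst ℝ ℝ (Fin n → ℝ))).prod convex_univ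
    · simp only [Prod.fst_add, Prod.smul_fst, smul_eq_mul]
      ring
  have hslice {p : ℝ × (Fin n → ℝ)} (hp : p ∈ S) :
      ERealConvexOn Set.univ (fun u => h (p, u)) := by
    intro u _ v _ a b ha hb hab
    have := hh (x := (p, u)) ⟨hp, trivial⟩ (y := (p, v)) ⟨hp, trivial⟩ ha hb hab
    simpa [← add_smul, hab] using this
  have hRconv : ERealConvexOn (S ×ˢ (Set.univ : Set (Fin m → ℝ)))
      (fun z => ((z.2 ⬝ᵥ (R *ᵥ z.2) : ℝ) : EReal)) :=
    fun z _ z' _ a b ha hb hab => hR.posSemidef.convexOn_dotProduct_mulVec.erealConvexOn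
      (Set.mem_univ z.2) (Set.mem_univ z'.2) ha hb hab
  have hQconv : ERealConvexOn S (fun p => ((p.2 ⬝ᵥ (Q *ᵥ p.2) : ℝ) : EReal)) :=
    fun p _ p' _ a b ha hb hab => hQ.convexOn_dotProduct_mulVec.erealConvexOn
      (Set.mem_univ p.2) (Set.mem_univ p'.2) ha hb hab
  have hV' := hQconv.add ((hRconv.add hh).iInf fun p hp hinf => by
    obtain ⟨u, hu⟩ := (hslice hp).exists_eq_bot_of_iInf_eq_bot hR hinf
    exact ⟨u, by simp [hu]⟩)
  intro V' l1 l2 x1 x2 a b h1 h2 ha hb hab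
  exact hV' (x := (l1, x1)) h1 (y := (l2, x2)) h2 ha hb hab
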